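/- arXiv:1801.09134 — 2 statements merged into one kernel-verified Lean document; each statement's English description precedes it below -/
import Mathlib

section
/- Let ε > 0 and let f : [0, ε] → ℝ be twice continuously differentiable on [0, ε] with f(ε) = 0. Then (f(0) + ε · f′(0))² ≤ ε³ · ∫₀^ε f″(s)² ds. -/
/-- One-dimensional core of Lemma 4.2: for a `C²` function on `[0, ε]` with
`f(ε) = 0` one has `(f(0) + ε f′(0))² ≤ ε³ ∫₀^ε f″(s)² ds`. -/
theorem stmt_5 (ε : ℝ) (hε : 0 < ε) (f f' f'' : ℝ → ℝ)
    (hderiv : ∀ τ ∈ Set.Icc (0:ℝ) ε, HasDerivWithinAt f (f' τ) (Set.Icc 0 ε) τ)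
    (hderiv' : ∀ τ ∈ Set.Icc (0:ℝ) ε, HasDerivWithinAt f' (f'' τ) (Set.Icc 0 ε) τ)
    (hcont : ContinuousOn f'' (Set.Icc (0:ℝ) ε))
    (hfε : f ε = 0) :
    (f 0 + ε * f' 0) ^ 2 ≤ ε ^ 3 * ∫ s in (0:ℝ)..ε, (f'' s) ^ 2 := by
  set A := f 0 + ε * f' 0 with hA
  set c : ℝ := 3 * A / ε ^ 3 with hc
  have hH : ∀ t ∈ Set.Icc (0:ℝ) ε, HasDerivWithinAt
      (fun t => c ^ 2 * (ε - t) ^ 3 / 3 - 2 * c * (f t + (ε - t) * f' t))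
      (-(c ^ 2 * (ε - t) ^ 2) - 2 * c * ((ε - t) * f'' t)) (Set.Icc 0 ε) t := by
    intro t ht
    have h1 : HasDerivWithinAt (fun t : ℝ => ε - t) (-1) (Set.Icc 0 ε) t :=
      (hasDerivWithinAt_id t _).const_sub ε
    have h2 := (((h1.pow 3).const_mul (c ^ 2)).div_const 3).sub
      (((hderiv t ht).add (h1.mul (hderiv' t ht))).const_mul (2 * c))
    refine h2.congr_deriv ?_
    norm_num
    ring
  have key := intervalIntegral.sub_le_integral_of_hasDeriv_right_of_le (φ := fun s => f'' s ^ 2)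
    hε.le (fun t ht => (hH t ht).continuousWithinAt)
    (fun t ht => ((hH t (Set.Ioo_subset_Icc_self ht)).hasDerivAt
      (Icc_mem_nhds ht.1 ht.2)).hasDerivWithinAt)
    ((hcont.pow 2).integrableOn_Icc)
    (fun t _ => by nlinarith [sq_nonneg (f'' t + c * (ε - t))])
  simp only [hfε, sub_self, sub_zero, ← hA] at key
  have e3 : 0 < ε ^ 3 := by positivity
  have hce : c * ε ^ 3 = 3 * A := by rw [hc]; field_simp
  have hJ : 0 ≤ ∫ s in (0:ℝ)..ε, (f'' s) ^ 2 :=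
    intervalIntegral.integral_nonneg hε.le (fun _ _ => sq_nonneg _)
  have h4 : c * A ≤ ∫ s in (0:ℝ)..ε, (f'' s) ^ 2 := by
    have : c ^ 2 * ε ^ 3 = 3 * (c * A) := by linear_combination c * hce
    linarith
  have h5 := mul_le_mul_of_nonneg_left h4 e3.le
  have : ε ^ 3 * (c * A) = 3 * A ^ 2 := by linear_combination A * hce
  nlinarith [sq_nonneg A]
end

section
/- Let ε > 0 and let f : [0, ε] → ℝ be twice continuously differentiable on [0, ε]. Then | ∫₀^ε f(τ) · (1 − τ/ε) dτ − (ε/2) · f(0) − (ε²/6) · f′(0) | ≤ (ε^{5/2}/6) · ( ∫₀^ε f″(s)² ds )^{1/2}. -/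
/-- One-dimensional core of estimate (est3): for a `C²` function on `[0, ε]`,
`|∫₀^ε f(τ)(1 − τ/ε) dτ − (ε/2) f(0) − (ε²/6) f′(0)| ≤ (ε^{5/2}/6)(∫₀^ε f″(s)² ds)^{1/2}`. -/
theorem stmt_8 (ε : ℝ) (hε : 0 < ε) (f f' f'' : ℝ → ℝ)
    (hderiv : ∀ τ ∈ Set.Icc (0:ℝ) ε, HasDerivWithinAt f (f' τ) (Set.Icc 0 ε) τ)
    (hderiv' : ∀ τ ∈ Set.Icc (0:ℝ) ε, HasDerivWithinAt f' (f'' τ) (Set.Icc 0 ε) τ)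
    (hcont : ContinuousOn f'' (Set.Icc (0:ℝ) ε)) :
    |(∫ τ in (0:ℝ)..ε, f τ * (1 - τ / ε)) - ε / 2 * f 0 - ε ^ 2 / 6 * f' 0|
      ≤ ε ^ ((5:ℝ)/2) / 6 * (∫ s in (0:ℝ)..ε, (f'' s) ^ 2) ^ ((1:ℝ)/2) := by
  have hne : ε ≠ 0 := hε.ne'
  have hfc : ContinuousOn f (Set.Icc 0 ε) := fun t ht => (hderiv t ht).continuousWithinAt
  have hfc' : ContinuousOn f' (Set.Icc 0 ε) := fun t ht => (hderiv' t ht).continuousWithinAt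
  have hint : ∀ g : ℝ → ℝ, ContinuousOn g (Set.Icc 0 ε) →
      IntervalIntegrable g MeasureTheory.volume 0 ε := fun g hg =>
    ContinuousOn.intervalIntegrable_of_Icc hε.le hg
  have hK : ∀ s : ℝ, HasDerivAt (fun s : ℝ => (ε - s) ^ 3 / (6 * ε)) (-(ε - s) ^ 2 / (2 * ε)) s := by
    intro s
    have h := ((((hasDerivAt_id s).const_sub ε).pow 3).div_const (6 * ε))
    refine h.congr_deriv ?_
    simp
    field_simp
    ring
  have hK' : ∀ s : ℝ, HasDerivAt (fun s : ℝ => -(ε - s) ^ 2 / (2 * ε)) (1 - s / ε) s := by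
    intro s
    have h := ((((hasDerivAt_id s).const_sub ε).pow 2).neg.div_const (2 * ε))
    refine h.congr_deriv ?_
    simp
    field_simp
  have hi1 : IntervalIntegrable (fun s => f'' s * ((ε - s) ^ 3 / (6 * ε)))
      MeasureTheory.volume 0 ε := hint _ (hcont.mul (by fun_prop))
  have hi2 : IntervalIntegrable (fun s => f s * (1 - s / ε))
      MeasureTheory.volume 0 ε := hint _ (hfc.mul (by fun_prop))
  have hftc := intervalIntegral.integral_eq_sub_of_hasDerivAt_of_le hε.le
    (f := fun s => f' s * ((ε - s) ^ 3 / (6 * ε)) - f s * (-(ε - s) ^ 2 / (2 * ε)))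
    (f' := fun s => f'' s * ((ε - s) ^ 3 / (6 * ε)) - f s * (1 - s / ε))
    ((hfc'.mul (by fun_prop)).sub (hfc.mul (by fun_prop)))
    (by
      intro s hs
      have hn := Icc_mem_nhds hs.1 hs.2
      have hs' := Set.Ioo_subset_Icc_self hs
      refine ((((hderiv' s hs').hasDerivAt hn).mul (hK s)).sub
        (((hderiv s hs').hasDerivAt hn).mul (hK' s))).congr_deriv ?_
      ring)
    (hi1.sub hi2)
  rw [intervalIntegral.integral_sub hi1 hi2] at hftc
  have hB : ∫ s in (0:ℝ)..ε, ((ε - s) ^ 3 / (6 * ε)) ^ 2 = ε ^ 5 / 252 := by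
    have h := intervalIntegral.integral_comp_sub_left (a := 0) (b := ε)
      (fun x : ℝ => (x ^ 3 / (6 * ε)) ^ 2) ε
    rw [h]
    simp only [div_pow, ← pow_mul, intervalIntegral.integral_div, integral_pow]
    norm_num
    field_simp
    norm_num
  have hR : (∫ τ in (0:ℝ)..ε, f τ * (1 - τ / ε)) - ε / 2 * f 0 - ε ^ 2 / 6 * f' 0
      = ∫ s in (0:ℝ)..ε, f'' s * ((ε - s) ^ 3 / (6 * ε)) := by
    have e1 : ε ^ 3 / (6 * ε) = ε ^ 2 / 6 := by field_simp
    have e2 : ε ^ 2 / (2 * ε) = ε / 2 := by field_simp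
    simp only [sub_self, sub_zero, neg_div, e1, e2] at hftc
    norm_num at hftc
    linarith
  rw [hR]
  set R := ∫ s in (0:ℝ)..ε, f'' s * ((ε - s) ^ 3 / (6 * ε)) with hRdef
  set A := ∫ s in (0:ℝ)..ε, (f'' s) ^ 2 with hA
  have hA0 : 0 ≤ A := intervalIntegral.integral_nonneg hε.le fun s _ => sq_nonneg _
  have hquad : ∀ t : ℝ, 0 ≤ A - 2 * t * R + t ^ 2 * (ε ^ 5 / 252) := by
    intro t
    have h0 : 0 ≤ ∫ s in (0:ℝ)..ε, (f'' s - t * ((ε - s) ^ 3 / (6 * ε))) ^ 2 :=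
      intervalIntegral.integral_nonneg hε.le fun s _ => sq_nonneg _
    have hi3 : IntervalIntegrable (fun s => (f'' s) ^ 2) MeasureTheory.volume 0 ε :=
      hint _ (hcont.pow 2)
    have hi4 : IntervalIntegrable (fun s => ((ε - s) ^ 3 / (6 * ε)) ^ 2)
      MeasureTheory.volume 0 ε := hint _ (by fun_prop)
    have he : ∫ s in (0:ℝ)..ε, (f'' s - t * ((ε - s) ^ 3 / (6 * ε))) ^ 2
        = ∫ s in (0:ℝ)..ε, ((f'' s) ^ 2 - 2 * t * (f'' s * ((ε - s) ^ 3 / (6 * ε)))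
          + t ^ 2 * ((ε - s) ^ 3 / (6 * ε)) ^ 2) := by
      congr 1
      ext s
      ring
    rw [he, intervalIntegral.integral_add (hi3.sub (hi1.const_mul _)) (hi4.const_mul _),
      intervalIntegral.integral_sub hi3 (hi1.const_mul _),
      intervalIntegral.integral_const_mul, intervalIntegral.integral_const_mul, hB] at h0
    exact h0
  have h5 : 0 < ε ^ 5 := by positivity
  have hCS : R ^ 2 ≤ A * (ε ^ 5 / 252) := by
    have h := hquad (R / (ε ^ 5 / 252))
    have e : A - 2 * (R / (ε ^ 5 / 252)) * R + (R / (ε ^ 5 / 252)) ^ 2 * (ε ^ 5 / 252)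
        = A - R ^ 2 / (ε ^ 5 / 252) := by
      field_simp
      ring
    rw [e, sub_nonneg, div_le_iff₀ (by positivity)] at h
    exact h
  refine abs_le_of_sq_le_sq ?_ (by positivity)
  have e1 : (ε ^ ((5:ℝ)/2)) ^ 2 = ε ^ 5 := by
    rw [← Real.rpow_natCast, ← Real.rpow_mul hε.le, ← Real.rpow_natCast]
    norm_num
  have e2 : (A ^ ((1:ℝ)/2)) ^ 2 = A := by
    rw [← Real.sqrt_eq_rpow, Real.sq_sqrt hA0]
  rw [mul_pow, div_pow, e1, e2]
  nlinarith [mul_nonneg hA0 h5.le]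
end
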